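/- Let (X, d) be a metric space with a coarse median μ with constant C ≥ 0 and upper control ρ satisfying ρ(t) ≥ t for all t ≥ 0. Suppose X is coarsely geodesic: there exist σ₀ ≥ 0 and an increasing proper function η : [0,∞) → [0,∞) such that d_{σ₀}(x,y) ≤ η(d(x,y)) for all x, y ∈ X. Then for every σ ≥ max(σ₀, C): (i) μ, regarded as a map on the extended metric space (X, d_σ), is a coarse median on (X, d_σ) with constant 1 and with upper control t ↦ η(ρ(σ)·t): it satisfies coarse symmetry, coarse localisation and the coarse four-point condition with error 1 in the metric d_σ, and d_σ(x,x'), d_σ(y,y'), d_σ(z,z') ≤ t implies d_σ(μ(x,y,z), μ(x',y',z')) ≤ η(ρ(σ)·t); (ii) the identity map from (X, d_σ) to (X, d) is controlled and 0-CMP with respect to these coarse medians. -/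

import Mathlib

open Filter

universe u v

/-- An upper control function: an increasing proper function `[0,∞) → [0,∞)`. -/
def ProperCtrl (ρ : ℝ → ℝ) : Prop :=
  Monotone ρ ∧ Tendsto ρ atTop atTop ∧ ∀ t : ℝ, 0 ≤ t → 0 ≤ ρ t

/-- `μ` is a coarse median on `X` with constant `C` and upper control `ρ`. -/
def IsCoarseMedian {X : Type*} [MetricSpace X] (μ : X → X → X → X) (C : ℝ) (ρ : ℝ → ℝ) : Prop :=
  (∀ (x x' y y' z z' : X) (t : ℝ), dist x x' ≤ t → dist y y' ≤ t → dist z z' ≤ t →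
      dist (μ x y z) (μ x' y' z') ≤ ρ t) ∧
  (∀ (τ : Equiv.Perm (Fin 3)) (v : Fin 3 → X),
      dist (μ (v (τ 0)) (v (τ 1)) (v (τ 2))) (μ (v 0) (v 1) (v 2)) ≤ C) ∧
  (∀ x y : X, dist (μ x x y) x ≤ C) ∧
  (∀ x y z w : X, dist (μ (μ x w y) w z) (μ x w (μ y w z)) ≤ C)

open ENNReal in
/-- The Rips metric at scale `σ`: `ripsDist σ x y` is the least `n : ℕ` such that `x` and
`y` are joined by a chain of `n` jumps of size at most `σ`, and `∞` if there is no
such chain. -/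
noncomputable def ripsDist {X : Type*} [MetricSpace X] (σ : ℝ) (x y : X) : ℝ≥0∞ :=
  sInf {e : ℝ≥0∞ | ∃ n : ℕ, e = n ∧ ∃ c : ℕ → X, c 0 = x ∧ c n = y ∧
    ∀ i < n, dist (c i) (c (i + 1)) ≤ σ}

/-- A single jump of size at most `σ` witnesses Rips distance at most `1`. -/
theorem ripsDist_le_one {X : Type*} [MetricSpace X] {σ : ℝ} {x y : X} (h : dist x y ≤ σ) :
    ripsDist σ x y ≤ 1 := by
  refine sInf_le ⟨1, by simp, fun i => if i = 0 then x else y, by simp, by simp, ?_⟩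
  intro i hi
  obtain rfl : i = 0 := by omega
  simpa using h

/-- The Rips distance decreases as the scale grows. -/
theorem ripsDist_anti {X : Type*} [MetricSpace X] {σ σ' : ℝ} (h : σ ≤ σ') (x y : X) :
    ripsDist σ' x y ≤ ripsDist σ x y := by
  refine sInf_le_sInf ?_
  rintro e ⟨n, he, c, h0, hn, hc⟩
  exact ⟨n, he, c, h0, hn, fun i hi => (hc i hi).trans h⟩

/-- Points at Rips distance at most `t` are joined by a chain of length exactly `⌊t⌋₊`. -/
theorem exists_chain_of_ripsDist_le {X : Type*} [MetricSpace X] {σ t : ℝ} (hσ : 0 ≤ σ)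
    {x y : X} (h : ripsDist σ x y ≤ ENNReal.ofReal t) :
    ∃ c : ℕ → X, c 0 = x ∧ c ⌊t⌋₊ = y ∧ ∀ i, dist (c i) (c (i + 1)) ≤ σ := by
  have hlt : ripsDist σ x y < ((⌊t⌋₊ + 1 : ℕ) : ENNReal) := by
    refine h.trans_lt ?_
    rw [← ENNReal.ofReal_natCast, ENNReal.ofReal_lt_ofReal_iff (by positivity)]
    exact_mod_cast Nat.lt_floor_add_one t
  obtain ⟨e, ⟨n, rfl, c, h0, hn, hc⟩, hlt⟩ := sInf_lt_iff.mp hlt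
  have hnt : n ≤ ⌊t⌋₊ := Nat.lt_succ_iff.mp (by exact_mod_cast hlt)
  refine ⟨fun i => c (min i n), by simpa using h0, by simpa [hnt] using hn, fun i => ?_⟩
  rcases lt_or_ge i n with hi | hi
  · simpa [hi.le, Nat.succ_le_of_lt hi] using hc i hi
  · simpa [hi, hi.trans (Nat.le_succ i)] using hσ

/-- The endpoint of a chain with `⌊t⌋₊` jumps of size at most `K` is within `K * t`. -/
theorem dist_chain_le {X : Type*} [MetricSpace X] {K t : ℝ} (hK : 0 ≤ K) (ht : 0 ≤ t)
    {c : ℕ → X} (hc : ∀ i, dist (c i) (c (i + 1)) ≤ K) :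
    dist (c 0) (c ⌊t⌋₊) ≤ K * t := by
  calc dist (c 0) (c ⌊t⌋₊) ≤ ∑ i ∈ Finset.range ⌊t⌋₊, K :=
        dist_le_range_sum_of_dist_le ⌊t⌋₊ fun {i} _ => hc i
    _ = K * ⌊t⌋₊ := by simp [mul_comm]
    _ ≤ K * t := mul_le_mul_of_nonneg_left (Nat.floor_le ht) hK

open ENNReal in
/-- on a coarsely geodesic coarse median space, the median is a coarse
median for the Rips metric at any sufficiently large scale, and the identity map from
the Rips metric to the original metric is controlled and `0`-CMP. -/
theorem rips_coarse_median {X : Type*} [MetricSpace X]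
    (μ : X → X → X → X) (C : ℝ) (ρ : ℝ → ℝ)
    (hC : 0 ≤ C) (hρ : ProperCtrl ρ) (hρt : ∀ t : ℝ, 0 ≤ t → t ≤ ρ t)
    (hμ : IsCoarseMedian μ C ρ)
    (σ₀ : ℝ) (hσ₀ : 0 ≤ σ₀) (η : ℝ → ℝ) (hη : ProperCtrl η)
    (hgeo : ∀ x y : X, ripsDist σ₀ x y ≤ ENNReal.ofReal (η (dist x y)))
    (σ : ℝ) (hσ : max σ₀ C ≤ σ) :
    -- (i) `μ` is a coarse median on `(X, d_σ)` with constant `1` and upper control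
    -- `t ↦ η (ρ σ * t)`:
    ((∀ (x x' y y' z z' : X) (t : ℝ), 0 ≤ t →
        ripsDist σ x x' ≤ ENNReal.ofReal t → ripsDist σ y y' ≤ ENNReal.ofReal t →
        ripsDist σ z z' ≤ ENNReal.ofReal t →
        ripsDist σ (μ x y z) (μ x' y' z') ≤ ENNReal.ofReal (η (ρ σ * t))) ∧
      (∀ (τ : Equiv.Perm (Fin 3)) (v : Fin 3 → X),
        ripsDist σ (μ (v (τ 0)) (v (τ 1)) (v (τ 2))) (μ (v 0) (v 1) (v 2)) ≤ 1) ∧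
      (∀ x y : X, ripsDist σ (μ x x y) x ≤ 1) ∧
      (∀ x y z w : X, ripsDist σ (μ (μ x w y) w z) (μ x w (μ y w z)) ≤ 1)) ∧
    -- (ii) the identity `(X, d_σ) → (X, d)` is controlled and `0`-CMP:
    ((∃ ρ' : ℝ → ℝ, ProperCtrl ρ' ∧ ∀ (x y : X) (t : ℝ), 0 ≤ t →
        ripsDist σ x y ≤ ENNReal.ofReal t → dist x y ≤ ρ' t) ∧
      ∀ x y z : X, dist (id (μ x y z)) (μ (id x) (id y) (id z)) ≤ 0) := by
  obtain ⟨hctrl, hsymm, hloc, hfour⟩ := hμ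
  have hσ₀σ : σ₀ ≤ σ := (le_max_left _ _).trans hσ
  have hCσ : C ≤ σ := (le_max_right _ _).trans hσ
  have hσ0 : 0 ≤ σ := hσ₀.trans hσ₀σ
  refine ⟨⟨?_, fun τ v => ripsDist_le_one ((hsymm τ v).trans hCσ),
    fun x y => ripsDist_le_one ((hloc x y).trans hCσ),
    fun x y z w => ripsDist_le_one ((hfour x y z w).trans hCσ)⟩, ?_, by simp⟩
  · intro x x' y y' z z' t ht hx hy hz
    obtain ⟨a, rfl, rfl, ha⟩ := exists_chain_of_ripsDist_le hσ0 hx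
    obtain ⟨b, rfl, rfl, hb⟩ := exists_chain_of_ripsDist_le hσ0 hy
    obtain ⟨c, rfl, rfl, hc⟩ := exists_chain_of_ripsDist_le hσ0 hz
    have hd := dist_chain_le (c := fun i => μ (a i) (b i) (c i)) (hρ.2.2 σ hσ0) ht
      fun i => hctrl _ _ _ _ _ _ σ (ha i) (hb i) (hc i)
    exact (ripsDist_anti hσ₀σ _ _).trans
      ((hgeo _ _).trans (ENNReal.ofReal_le_ofReal (hη.1 hd)))
  · refine ⟨fun t => (σ + 1) * t, ⟨?_, ?_, fun t ht => by positivity⟩, ?_⟩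
    · exact monotone_id.const_mul (by positivity)
    · exact tendsto_id.const_mul_atTop (by positivity)
    · intro x y t ht hxy
      obtain ⟨c, rfl, rfl, hc⟩ := exists_chain_of_ripsDist_le hσ0 hxy
      exact dist_chain_le (by positivity) ht fun i => (hc i).trans (by linarith)
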